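/- arXiv:2005.08492 — 3 statements merged into one kernel-verified Lean document; each statement's English description precedes it below -/
import Mathlib

section
/- Let X be a separable real Banach space. Then the following are equivalent: (a) there exists a > 0 such that R(a, X) < 1 + a; (b) R(a, X) < 1 + a for all a > 0; (c) R(1, X) < 2. -/
open Filter Topology

/-- The Domínguez-Benavides coefficient `R(a, X)`. -/
noncomputable def RCoeff (X : Type*) [NormedAddCommGroup X] [NormedSpace ℝ X] (a : ℝ) : ℝ :=
  sSup {r : ℝ | ∃ (x : X) (xs : ℕ → X), ‖x‖ ≤ a ∧ (∀ n, ‖xs n‖ ≤ 1) ∧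
    (∀ f : X →L[ℝ] ℝ, Filter.Tendsto (fun n => f (xs n)) Filter.atTop (nhds 0)) ∧
    Filter.limsup (fun n => Filter.limsup (fun m => ‖xs n - xs m‖) Filter.atTop) Filter.atTop ≤ 1 ∧
    r = Filter.liminf (fun n => ‖xs n + x‖) Filter.atTop}

section NormBound

variable {X : Type*} [NormedAddCommGroup X]

lemma norm_add_le_one_add {x y : X} {a : ℝ} (hx : ‖x‖ ≤ a) (hy : ‖y‖ ≤ 1) :
    ‖y + x‖ ≤ 1 + a :=
  (norm_add_le _ _).trans (add_le_add hy hx)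

lemma isBoundedUnder_ge_norm (u : ℕ → X) :
    IsBoundedUnder (· ≥ ·) atTop (fun n => ‖u n‖) :=
  isBoundedUnder_of ⟨0, fun _ => norm_nonneg _⟩

lemma isCoboundedUnder_ge_norm_add {x : X} {xs : ℕ → X} {a : ℝ} (hx : ‖x‖ ≤ a)
    (hxs : ∀ n, ‖xs n‖ ≤ 1) : IsCoboundedUnder (· ≥ ·) atTop (fun n => ‖xs n + x‖) :=
  (isBoundedUnder_of (r := (· ≤ ·))
    ⟨1 + a, fun n => norm_add_le_one_add hx (hxs n)⟩).isCoboundedUnder_ge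

variable [NormedSpace ℝ X]

/-- If `‖y + x‖` almost attains its upper bound `1 + a`, then `‖y + t • x‖` almost attains its
upper bound `1 + t * a`. -/
lemma le_norm_add_smul {x y : X} {a t ε : ℝ} (ht : 0 ≤ t) (hx : ‖x‖ ≤ a) (hy : ‖y‖ ≤ 1)
    (hε : 0 ≤ ε) (h : 1 + a - ε ≤ ‖y + x‖) : 1 + t * a - (1 + t) * ε ≤ ‖y + t • x‖ := by
  rcases le_total t 1 with h1 | h1
  · have key : ‖y + x‖ ≤ ‖y + t • x‖ + (1 - t) * ‖x‖ := by
      rw [← norm_smul_of_nonneg (sub_nonneg.2 h1)]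
      refine le_of_eq_of_le (congrArg norm ?_) (norm_add_le _ _)
      module
    nlinarith [mul_le_mul_of_nonneg_left hx (sub_nonneg.2 h1), mul_nonneg ht hε]
  · have key : t * ‖y + x‖ ≤ ‖y + t • x‖ + (t - 1) * ‖y‖ := by
      rw [← norm_smul_of_nonneg ht, ← norm_smul_of_nonneg (sub_nonneg.2 h1)]
      refine le_of_eq_of_le (congrArg norm ?_) (norm_add_le _ _)
      module
    nlinarith [mul_le_mul_of_nonneg_left hy (sub_nonneg.2 h1), mul_le_mul_of_nonneg_left h ht]

variable (X)

lemma le_RCoeff {a c : ℝ} {x : X} {xs : ℕ → X} (hx : ‖x‖ ≤ a) (hxs : ∀ n, ‖xs n‖ ≤ 1)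
    (hw : ∀ f : X →L[ℝ] ℝ, Tendsto (fun n => f (xs n)) atTop (𝓝 0))
    (hD : limsup (fun n => limsup (fun m => ‖xs n - xs m‖) atTop) atTop ≤ 1)
    (hc : ∀ᶠ n in atTop, c ≤ ‖xs n + x‖) : c ≤ RCoeff X a := by
  refine (le_liminf_of_le (isCoboundedUnder_ge_norm_add hx hxs) hc).trans
    (le_csSup ⟨1 + a, ?_⟩ ⟨x, xs, hx, hxs, hw, hD, rfl⟩)
  rintro _ ⟨y, ys, hy, hys, -, -, rfl⟩
  exact liminf_le_of_frequently_le
    (Frequently.of_forall fun n => norm_add_le_one_add hy (hys n)) (isBoundedUnder_ge_norm _)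

lemma exists_of_lt_RCoeff {a c : ℝ} (ha : 0 ≤ a) (hc : c < RCoeff X a) :
    ∃ (x : X) (xs : ℕ → X), ‖x‖ ≤ a ∧ (∀ n, ‖xs n‖ ≤ 1) ∧
      (∀ f : X →L[ℝ] ℝ, Tendsto (fun n => f (xs n)) atTop (𝓝 0)) ∧
      limsup (fun n => limsup (fun m => ‖xs n - xs m‖) atTop) atTop ≤ 1 ∧
      ∀ᶠ n in atTop, c < ‖xs n + x‖ := by
  obtain ⟨_, ⟨x, xs, hx, hxs, hw, hD, rfl⟩, hr⟩ := exists_lt_of_lt_csSup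
    (by exact ⟨_, 0, fun _ => 0, by simpa using ha, by simp, by simp, by simp, rfl⟩) hc
  exact ⟨x, xs, hx, hxs, hw, hD, eventually_lt_of_lt_liminf hr (isBoundedUnder_ge_norm _)⟩

/-- Whether `R(a, X)` lies strictly below its trivial bound `1 + a` does not depend on `a > 0`. -/
lemma RCoeff_lt_one_add_of_lt {a b : ℝ} (ha : 0 < a) (hb : 0 < b) (h : RCoeff X b < 1 + b) :
    RCoeff X a < 1 + a := by
  by_contra! hcon
  set t := b / a with ht_def
  have ht : 0 < t := div_pos hb ha
  have hta : t * a = b := div_mul_cancel₀ b ha.ne'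
  obtain ⟨ε, hε, hεt⟩ : ∃ ε > 0, (1 + t) * ε < 1 + b - RCoeff X b :=
    exists_pos_mul_lt (sub_pos.2 h) _
  obtain ⟨x, xs, hx, hxs, hw, hD, hlt⟩ :=
    exists_of_lt_RCoeff X ha.le (show 1 + a - ε < RCoeff X a by linarith)
  have htx : ‖t • x‖ ≤ b := by
    rw [norm_smul_of_nonneg ht.le, ← hta]
    gcongr
  have hle : 1 + t * a - (1 + t) * ε ≤ RCoeff X b :=
    le_RCoeff X htx hxs hw hD
      (hlt.mono fun n hn => le_norm_add_smul ht.le hx (hxs n) hε.le hn.le)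
  linarith

end NormBound

theorem stmt1 (X : Type*) [NormedAddCommGroup X] [NormedSpace ℝ X] [CompleteSpace X]
    [TopologicalSpace.SeparableSpace X] :
    ((∃ a : ℝ, 0 < a ∧ RCoeff X a < 1 + a) ↔ (∀ a : ℝ, 0 < a → RCoeff X a < 1 + a)) ∧
    ((∃ a : ℝ, 0 < a ∧ RCoeff X a < 1 + a) ↔ RCoeff X 1 < 2) := by
  rw [← one_add_one_eq_two]
  exact ⟨⟨fun ⟨_, hb, h⟩ _ ha => RCoeff_lt_one_add_of_lt X ha hb h,
      fun h => ⟨1, one_pos, h 1 one_pos⟩⟩,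
    ⟨fun ⟨_, hb, h⟩ => RCoeff_lt_one_add_of_lt X one_pos hb h, fun h => ⟨1, one_pos, h⟩⟩⟩
end

section
/- Let X be a separable real Banach space. Then R(a, X) = a for all a ≥ 1 if and only if R(1, X) = 1. -/
open Filter Topology

lemma isBoundedUnder_le_of_forall_le {u : ℕ → ℝ} {C : ℝ} (h : ∀ n, u n ≤ C) :
    IsBoundedUnder (· ≤ ·) atTop u :=
  isBoundedUnder_of ⟨C, h⟩

lemma isBoundedUnder_ge_of_forall_ge {u : ℕ → ℝ} {c : ℝ} (h : ∀ n, c ≤ u n) :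
    IsBoundedUnder (· ≥ ·) atTop u :=
  isBoundedUnder_of ⟨c, h⟩

/-- Pointwise domination of nonnegative bounded double sequences passes to iterated limsups. -/
lemma limsup_limsup_le_limsup_limsup {u v : ℕ → ℕ → ℝ} {C : ℝ} (hu : ∀ n m, 0 ≤ u n m)
    (huv : ∀ n m, u n m ≤ v n m) (hv : ∀ n m, v n m ≤ C) :
    limsup (fun n => limsup (u n) atTop) atTop ≤ limsup (fun n => limsup (v n) atTop) atTop := by
  have hlim : ∀ n, limsup (u n) atTop ≤ limsup (v n) atTop := fun n =>
    limsup_le_limsup (Eventually.of_forall (huv n))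
      (isBoundedUnder_ge_of_forall_ge (hu n)).isCoboundedUnder_le
      (isBoundedUnder_le_of_forall_le (hv n))
  have hnonneg : ∀ n, 0 ≤ limsup (u n) atTop := fun n =>
    le_limsup_of_frequently_le (Frequently.of_forall (hu n))
      (isBoundedUnder_le_of_forall_le fun m => (huv n m).trans (hv n m))
  have hle : ∀ n, limsup (v n) atTop ≤ C := fun n =>
    limsup_le_of_le (isBoundedUnder_ge_of_forall_ge
      fun m => (hu n m).trans (huv n m)).isCoboundedUnder_le (Eventually.of_forall (hv n))
  exact limsup_le_limsup (Eventually.of_forall hlim)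
    (isBoundedUnder_ge_of_forall_ge hnonneg).isCoboundedUnder_le
    (isBoundedUnder_le_of_forall_le hle)

lemma liminf_norm_add_le {X : Type*} [SeminormedAddCommGroup X] {xs : ℕ → X} {x : X} {a : ℝ}
    (hxs : ∀ n, ‖xs n‖ ≤ 1) (hx : ‖x‖ ≤ a) :
    liminf (fun n => ‖xs n + x‖) atTop ≤ 1 + a := by
  have h : ∀ n, ‖xs n + x‖ ≤ 1 + a := fun n =>
    (norm_add_le _ _).trans (add_le_add (hxs n) hx)
  exact liminf_le_of_frequently_le (Frequently.of_forall h)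
    (isBoundedUnder_ge_of_forall_ge fun n => norm_nonneg (xs n + x))

section RCoeff

variable {X : Type*} [NormedAddCommGroup X] [NormedSpace ℝ X]

lemma liminf_norm_add_le_RCoeff {xs : ℕ → X} {x : X} {a : ℝ} (hx : ‖x‖ ≤ a)
    (hxs : ∀ n, ‖xs n‖ ≤ 1)
    (hweak : ∀ f : X →L[ℝ] ℝ, Tendsto (fun n => f (xs n)) atTop (𝓝 0))
    (hsep : limsup (fun n => limsup (fun m => ‖xs n - xs m‖) atTop) atTop ≤ 1) :
    liminf (fun n => ‖xs n + x‖) atTop ≤ RCoeff X a := by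
  refine le_csSup ⟨1 + a, ?_⟩ ⟨x, xs, hx, hxs, hweak, hsep, rfl⟩
  rintro r ⟨y, ys, hy, hys, -, -, rfl⟩
  exact liminf_norm_add_le hys hy

lemma RCoeff_eq_zero_of_subsingleton [Subsingleton X] (a : ℝ) : RCoeff X a = 0 := by
  have h : ∀ (xs : ℕ → X) (x : X), liminf (fun n => ‖xs n + x‖) atTop = 0 := fun xs x => by
    simp [Subsingleton.elim (_ : X) 0]
  refine le_antisymm (Real.sSup_nonpos ?_) (Real.sSup_nonneg ?_) <;>
  · rintro r ⟨x, xs, -, -, -, -, rfl⟩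
    simp [h]

lemma le_RCoeff_s4 [Nontrivial X] {a : ℝ} (ha : 0 ≤ a) : a ≤ RCoeff X a := by
  obtain ⟨x, hx⟩ := exists_norm_eq X ha
  simpa [hx] using liminf_norm_add_le_RCoeff (xs := fun _ => (0 : X)) hx.le (by simp) (by simp)
    (by simp)

lemma RCoeff_le_mul_RCoeff_one {a : ℝ} (ha : 1 ≤ a) : RCoeff X a ≤ a * RCoeff X 1 := by
  have ha0 : 0 < a := one_pos.trans_le ha
  have hinv : a⁻¹ ≤ 1 := inv_le_one_of_one_le₀ ha
  have hnorm : ∀ y : X, ‖a⁻¹ • y‖ = a⁻¹ * ‖y‖ := fun y => by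
    rw [norm_smul, Real.norm_of_nonneg (inv_nonneg.2 ha0.le)]
  have hsmul : ∀ y : X, ‖a⁻¹ • y‖ ≤ ‖y‖ := fun y => by
    rw [hnorm]
    exact mul_le_of_le_one_left (norm_nonneg y) hinv
  refine csSup_le ⟨_, 0, 0, by simpa using ha0.le, by simp, by simp, by simp, rfl⟩ ?_
  rintro r ⟨x, xs, hx, hxs, hweak, hsep, rfl⟩
  have hle := liminf_norm_add_le_RCoeff (x := a⁻¹ • x) (xs := fun n => a⁻¹ • xs n) (a := 1)
    (by rw [hnorm]; exact (inv_mul_le_one₀ ha0).2 hx)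
    (fun n => (hsmul _).trans (hxs n))
    (fun f => by simpa using (hweak f).const_mul a⁻¹)
    ((limsup_limsup_le_limsup_limsup (C := 2) (fun _ _ => norm_nonneg _)
      (fun n m => by rw [← smul_sub]; exact hsmul _)
      (fun n m => (norm_sub_le _ _).trans (by linarith [hxs n, hxs m]))).trans hsep)
  have hbdd : IsBoundedUnder (· ≤ ·) atTop fun n => ‖xs n + x‖ :=
    isBoundedUnder_le_of_forall_le fun n =>
      (norm_add_le _ _).trans (add_le_add (hxs n) hx)
  have hmul : a⁻¹ * liminf (fun n => ‖xs n + x‖) atTop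
      = liminf (fun n => ‖a⁻¹ • xs n + a⁻¹ • x‖) atTop := by
    simp only [← smul_add, hnorm]
    exact (monotone_mul_left_of_nonneg (inv_nonneg.2 ha0.le)).map_liminf_of_continuousAt _
      (continuous_const_mul a⁻¹).continuousAt hbdd.isCoboundedUnder_ge
      (isBoundedUnder_ge_of_forall_ge fun n => norm_nonneg (xs n + x))
  rw [← hmul] at hle
  exact (inv_mul_le_iff₀ ha0).1 hle

end RCoeff

theorem stmt4 (X : Type*) [NormedAddCommGroup X] [NormedSpace ℝ X] [CompleteSpace X]
    [TopologicalSpace.SeparableSpace X] :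
    (∀ a : ℝ, 1 ≤ a → RCoeff X a = a) ↔ RCoeff X 1 = 1 := by
  refine ⟨fun h => h 1 le_rfl, fun h a ha => ?_⟩
  rcases subsingleton_or_nontrivial X with _ | _
  · simp [RCoeff_eq_zero_of_subsingleton] at h
  · refine le_antisymm ?_ (le_RCoeff_s4 (zero_le_one.trans ha))
    simpa [h] using RCoeff_le_mul_RCoeff_one (X := X) ha
end

section
/- Let X be a separable real Banach space and let a, b be real numbers with 0 < a ≤ b. Then a·RW(b, X) ≤ b·RW(a, X); equivalently, the function a ↦ RW(a, X)/a is nonincreasing on (0, ∞). -/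
open Filter Topology

/-- The coefficient `RW(a, X)` of García-Falset, Llorens-Fuster and Mazcuñán-Navarro. -/
noncomputable def RWCoeff (X : Type*) [NormedAddCommGroup X] [NormedSpace ℝ X] (a : ℝ) : ℝ :=
  sSup {r : ℝ | ∃ (x : X) (xs : ℕ → X), ‖x‖ ≤ a ∧ (∀ n, ‖xs n‖ ≤ 1) ∧
    (∀ f : X →L[ℝ] ℝ, Filter.Tendsto (fun n => f (xs n)) Filter.atTop (nhds 0)) ∧
    r = min (Filter.liminf (fun n => ‖xs n + x‖) Filter.atTop)
            (Filter.liminf (fun n => ‖xs n - x‖) Filter.atTop)}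

/-- The real `liminf` along `atTop` of a bounded sequence commutes with nonnegative scaling. -/
theorem liminf_const_mul_of_bounded {u : ℕ → ℝ} {c C : ℝ} (hc : 0 ≤ c) (h0 : ∀ n, 0 ≤ u n)
    (hC : ∀ n, u n ≤ C) :
    liminf (fun n => c * u n) atTop = c * liminf u atTop :=
  ((monotone_mul_left_of_nonneg hc).map_liminf_of_continuousAt u
    (continuous_const_mul c).continuousAt
    (isBoundedUnder_of ⟨C, hC⟩).isCoboundedUnder_ge (isBoundedUnder_of ⟨0, h0⟩)).symm

/-- For bounded sequences, the `liminf` of the norms is at most the bound. -/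
theorem liminf_norm_le_of_norm_le {X : Type*} [NormedAddCommGroup X] {u : ℕ → X} {C : ℝ}
    (hC : ∀ n, ‖u n‖ ≤ C) : liminf (fun n => ‖u n‖) atTop ≤ C :=
  liminf_le_of_le (isBoundedUnder_of ⟨0, fun n => norm_nonneg (u n)⟩) fun _ h =>
    let ⟨n, hn⟩ := h.exists
    hn.trans (hC n)

theorem stmt6 (X : Type*) [NormedAddCommGroup X] [NormedSpace ℝ X] [CompleteSpace X]
    [TopologicalSpace.SeparableSpace X] (a b : ℝ) (ha : 0 < a) (hab : a ≤ b) :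
    a * RWCoeff X b ≤ b * RWCoeff X a := by
  have hb : 0 < b := ha.trans_le hab
  have key : RWCoeff X b ≤ b / a * RWCoeff X a := by
    refine csSup_le ⟨_, 0, 0, by simpa using hb.le, by simp, by simp, rfl⟩ ?_
    rintro r ⟨x, xs, hx, hxs, hw, rfl⟩
    have ht : 0 ≤ a / b := by positivity
    have hadd : ∀ n, ‖xs n + x‖ ≤ 1 + b := fun n =>
      (norm_add_le _ _).trans (add_le_add (hxs n) hx)
    have hsub : ∀ n, ‖xs n - x‖ ≤ 1 + b := fun n =>
      (norm_sub_le _ _).trans (add_le_add (hxs n) hx)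
    rw [← div_le_iff₀' (by positivity), div_eq_inv_mul, inv_div]
    refine le_csSup ⟨1 + a, ?_⟩ ⟨(a / b) • x, fun n => (a / b) • xs n, ?_, fun n => ?_,
      fun f => ?_, ?_⟩
    · rintro r ⟨y, ys, hy, hys, -, rfl⟩
      exact (min_le_left _ _).trans (liminf_norm_le_of_norm_le fun n =>
        (norm_add_le _ _).trans (add_le_add (hys n) hy))
    · rw [norm_smul, Real.norm_of_nonneg ht]
      calc a / b * ‖x‖ ≤ a / b * b := by gcongr
        _ = a := div_mul_cancel₀ a hb.ne'
    · rw [norm_smul, Real.norm_of_nonneg ht]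
      exact mul_le_one₀ ((div_le_one hb).2 hab) (norm_nonneg _) (hxs n)
    · simpa using (hw f).const_mul (a / b)
    · simp only [← smul_add, ← smul_sub, norm_smul, Real.norm_of_nonneg ht]
      rw [liminf_const_mul_of_bounded ht (fun n => norm_nonneg _) hadd,
        liminf_const_mul_of_bounded ht (fun n => norm_nonneg _) hsub,
        mul_min_of_nonneg _ _ ht]
  calc a * RWCoeff X b ≤ a * (b / a * RWCoeff X a) := by gcongr
    _ = b * RWCoeff X a := by field_simp
end
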